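/- Under the same setup, if Lu ≥ 0 in U_T (non-strict inequality), then still u ≥ min over Γ(U_T) of u throughout U_T. (Strong maximum principle obtained by perturbing with w = Kt + u and letting K → 0.) -/

import Mathlib

open Set

/-- Second derivative at a local minimum in one variable. -/
theorem aux_second_deriv_nonneg (g : ℝ → ℝ) (a : ℝ) (hmin : IsLocalMin g a)
    (hc : ContinuousAt g a) : 0 ≤ deriv (deriv g) a := by
  by_contra hneg
  push Not at hneg
  have hmax : IsLocalMax g a :=
    isLocalMax_of_deriv_deriv_neg hneg hmin.deriv_eq_zero hc
  have heq : g =ᶠ[nhds a] fun _ => g a := by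
    filter_upwards [hmin, hmax] with y h1 h2
    exact le_antisymm h2 h1
  have h2 : deriv (deriv g) a = 0 := by
    rw [heq.deriv.deriv_eq]
    simp
  linarith

theorem aux_hess_nonneg {E : Type*} [NormedAddCommGroup E] [NormedSpace ℝ E]
    (f : E → ℝ) (x e : E) (hf : ContDiffAt ℝ 2 f x)
    (hmin : IsLocalMin f x) :
    0 ≤ fderiv ℝ (fun y => fderiv ℝ f y e) x e := by
  have hline : ∀ s : ℝ, HasDerivAt (fun s : ℝ => x + s • e) e s := by
    intro s
    simpa using ((hasDerivAt_id s).smul_const e).const_add x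
  have hlc : Filter.Tendsto (fun s : ℝ => x + s • e) (nhds 0) (nhds x) := by
    have := (hline 0).continuousAt.tendsto
    simpa using this
  have hdiff : ∀ᶠ y in nhds x, DifferentiableAt ℝ f y := by
    filter_upwards [hf.eventually (by simp)] with y hy
    exact hy.differentiableAt (by simp)
  have hd1 : deriv (fun s : ℝ => f (x + s • e)) =ᶠ[nhds 0]
      fun s => fderiv ℝ f (x + s • e) e := by
    filter_upwards [hlc.eventually hdiff] with s hs
    exact (hs.hasFDerivAt.comp_hasDerivAt s (hline s)).deriv
  have hF : DifferentiableAt ℝ (fun y => fderiv ℝ f y e) x := by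
    have : DifferentiableAt ℝ (fderiv ℝ f) x :=
      (hf.fderiv_right (m := 1) (by norm_num)).differentiableAt (by simp)
    exact this.clm_apply (differentiableAt_const e)
  have hd2 : deriv (deriv (fun s : ℝ => f (x + s • e))) 0
      = fderiv ℝ (fun y => fderiv ℝ f y e) x e := by
    rw [hd1.deriv_eq]
    have hF' : HasFDerivAt (fun y => fderiv ℝ f y e)
        (fderiv ℝ (fun y => fderiv ℝ f y e) x) (x + (0:ℝ) • e) := by
      simpa using hF.hasFDerivAt
    exact (hF'.comp_hasDerivAt (0:ℝ) (hline 0)).deriv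
  rw [← hd2]
  apply aux_second_deriv_nonneg
  · have := hlc.eventually hmin
    filter_upwards [this] with s hs
    simpa using hs
  · have h1 : ContinuousAt f (x + (0:ℝ) • e) := by simpa using hf.continuousAt
    exact ContinuousAt.comp (f := fun s : ℝ => x + s • e) h1 (hline 0).continuousAt

/-- Weak maximum (minimum) principle for the degenerate non-divergence operator
`Lu ≥ 0` (non-strict): strong maximum (minimum) principle. -/
theorem strong_maximum_principle
    (d : ℕ) (U : Set (EuclideanSpace ℝ (Fin d))) (T τ₀ σ2 γ β Δe : ℝ)
    (hU : IsOpen U) (hUb : Bornology.IsBounded U) (hUne : U.Nonempty)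
    (hT : 0 < T) (hτ₀ : 0 < τ₀) (hσ : 0 < σ2) (hγ : 0 ≤ γ) (hβ : 0 ≤ β)
    (u : EuclideanSpace ℝ (Fin d) × ℝ → ℝ)
    (hu0 : ∀ p ∈ closure U ×ˢ Icc 0 T, 0 ≤ u p)
    (hcont : ContinuousOn u (closure U ×ˢ Icc 0 T))
    (hx : ∀ t ∈ Ioc 0 T, ContDiffOn ℝ 2 (fun x => u (x, t)) U)
    (ht : ∀ x ∈ U, ∀ t ∈ Ioc 0 T, DifferentiableAt ℝ (fun s => u (x, s)) t)
    (hL : ∀ x ∈ U, ∀ t ∈ Ioc 0 T,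
      0 ≤ τ₀ * deriv (fun s => u (x, s)) t
          + (u (x, t)) ^ γ * ‖gradient (fun y => u (y, t)) x‖ ^ β * Δe *
              (∑ i : Fin d, gradient (fun y => u (y, t)) x i)
          - σ2 / 2 * (u (x, t)) ^ γ * ‖gradient (fun y => u (y, t)) x‖ ^ β *
              (∑ i : Fin d,
                fderiv ℝ (fun y => fderiv ℝ (fun z => u (z, t)) y
                    (EuclideanSpace.single i (1 : ℝ))) x (EuclideanSpace.single i (1 : ℝ)))) :
    ∀ x ∈ U, ∀ t ∈ Ioc 0 T,
      sInf (u '' ((U ×ˢ {(0 : ℝ)}) ∪ (frontier U ×ˢ Ioc 0 T))) ≤ u (x, t) := by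
  intro x₀ hx₀ t₀ ht₀
  by_contra hlt
  push Not at hlt
  set m := sInf (u '' ((U ×ˢ {(0 : ℝ)}) ∪ (frontier U ×ˢ Ioc 0 T))) with hm
  have hbdd : BddBelow (u '' ((U ×ˢ {(0 : ℝ)}) ∪ (frontier U ×ˢ Ioc 0 T))) := by
    refine ⟨0, ?_⟩
    rintro _ ⟨⟨y, s⟩, hy, rfl⟩
    apply hu0
    rcases hy with ⟨h1, h2⟩ | ⟨h1, h2⟩
    · simp only [mem_singleton_iff] at h2
      exact ⟨subset_closure h1, by rw [h2]; exact ⟨le_rfl, hT.le⟩⟩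
    · exact ⟨frontier_subset_closure h1, Ioc_subset_Icc_self h2⟩
  have hlat : ∀ y ∈ frontier U, ∀ s ∈ Ioc 0 T, m ≤ u (y, s) := fun y hy s hs =>
    csInf_le hbdd ⟨(y, s), Or.inr ⟨hy, hs⟩, rfl⟩
  have hbot0 : ∀ y ∈ U, m ≤ u (y, 0) := fun y hy =>
    csInf_le hbdd ⟨(y, 0), Or.inl ⟨hy, rfl⟩, rfl⟩
  have hbot : ∀ y ∈ closure U, m ≤ u (y, 0) := by
    have hc0 : ContinuousOn (fun y => u (y, (0:ℝ))) (closure U) := by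
      refine hcont.comp (by fun_prop) ?_
      intro y hy
      exact ⟨hy, le_rfl, hT.le⟩
    intro y hy
    exact le_on_closure (f := fun _ => m) (g := fun y => u (y, (0:ℝ)))
      hbot0 continuousOn_const hc0 hy
  obtain ⟨K, hK, hKlt⟩ : ∃ K > 0, u (x₀, t₀) + K * t₀ < m := by
    refine ⟨(m - u (x₀, t₀)) / (2 * t₀), div_pos (by linarith) (by linarith [ht₀.1]), ?_⟩
    have : (m - u (x₀, t₀)) / (2 * t₀) * t₀ = (m - u (x₀, t₀)) / 2 := by
      have := ht₀.1.ne'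
      field_simp
    rw [this]; linarith
  have hcomp : IsCompact (closure U ×ˢ Icc (0:ℝ) T) :=
    hUb.isCompact_closure.prod isCompact_Icc
  have hcw : ContinuousOn (fun p : EuclideanSpace ℝ (Fin d) × ℝ => u p + K * p.2)
      (closure U ×ˢ Icc 0 T) := hcont.add (by fun_prop)
  have hmem₀ : (x₀, t₀) ∈ closure U ×ˢ Icc (0:ℝ) T :=
    ⟨subset_closure hx₀, Ioc_subset_Icc_self ht₀⟩
  obtain ⟨⟨x, t⟩, ⟨hxc, htc⟩, hmin⟩ := hcomp.exists_isMinOn ⟨_, hmem₀⟩ hcw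
  simp only at hxc htc
  have hmin' : ∀ y ∈ closure U, ∀ s ∈ Icc 0 T, u (x, t) + K * t ≤ u (y, s) + K * s :=
    fun y hy s hs => hmin (show (y, s) ∈ _ from ⟨hy, hs⟩)
  have hval : u (x, t) + K * t < m :=
    lt_of_le_of_lt (hmin' x₀ hmem₀.1 t₀ hmem₀.2) hKlt
  have htpos : 0 < t := by
    rcases htc.1.lt_or_eq with h | h
    · exact h
    · have := hbot x hxc
      rw [← h] at hval
      linarith
  have htI : t ∈ Ioc 0 T := ⟨htpos, htc.2⟩
  have hxU : x ∈ U := by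
    by_contra hxn
    have : x ∈ frontier U := by
      rw [hU.frontier_eq]; exact ⟨hxc, hxn⟩
    have h1 := hlat x this t htI
    have h2 : 0 < K * t := mul_pos hK htpos
    linarith
  have hlocmin : IsLocalMin (fun y => u (y, t)) x := by
    filter_upwards [hU.mem_nhds hxU] with y hy
    have := hmin' y (subset_closure hy) t htc
    linarith
  have hgrad : gradient (fun y => u (y, t)) x = 0 := by
    unfold gradient
    rw [hlocmin.fderiv_eq_zero, map_zero]
  have hcd : ContDiffAt ℝ 2 (fun y => u (y, t)) x :=
    (hx t htI).contDiffAt (hU.mem_nhds hxU)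
  have hlap : 0 ≤ ∑ i : Fin d,
      fderiv ℝ (fun y => fderiv ℝ (fun z => u (z, t)) y
        (EuclideanSpace.single i (1 : ℝ))) x (EuclideanSpace.single i (1 : ℝ)) :=
    Finset.sum_nonneg fun i _ => aux_hess_nonneg _ x _ hcd hlocmin
  have htd : deriv (fun s => u (x, s)) t ≤ -K := by
    have hd := (ht x hxU t htI).hasDerivAt.hasDerivWithinAt (s := Iio t)
    rw [hasDerivWithinAt_iff_tendsto_slope' (by simp)] at hd
    refine le_of_tendsto hd ?_
    filter_upwards [Ioo_mem_nhdsLT htpos] with s hs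
    have h1 := hmin' x hxc s ⟨hs.1.le, hs.2.le.trans htc.2⟩
    rw [slope_def_field, div_le_iff_of_neg (by linarith [hs.2])]
    linarith
  have h := hL x hxU t htI
  have hc : 0 ≤ σ2 / 2 * (u (x, t)) ^ γ * ‖gradient (fun y => u (y, t)) x‖ ^ β := by
    have := hu0 (x, t) ⟨hxc, htc⟩
    positivity
  have h3 := mul_nonneg hc hlap
  have h4 : ∑ i : Fin d, gradient (fun y => u (y, t)) x i = 0 := by
    rw [hgrad]; simp
  rw [h4, mul_zero] at h
  have h5 : τ₀ * deriv (fun s => u (x, s)) t ≤ τ₀ * (-K) :=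
    mul_le_mul_of_nonneg_left htd hτ₀.le
  have h6 := mul_pos hτ₀ hK
  linarith
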